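/- arXiv:1111.6403 — 5 statements merged into one kernel-verified Lean document; each statement's English description precedes it below -/
import Mathlib

section
/- Let p, q ≥ 1 and l, m, b be natural numbers, let D be a real m×l matrix and T a real b×l matrix. On the real vector space 𝒱 = (ℝ^l × ℝ^m × ℝ^b) × (ℝ^l × ℝ^m × ℝ^b), whose elements are pairs ((f_p, f_q, f_b), (e_p, e_q, e_b)) of flows and efforts, define the symmetric bilinear form ⟨⟨(f¹,e¹),(f²,e²)⟩⟩ = (e_p¹·f_p² + e_p²·f_p¹) + (−1)^{q(p−1)} (e_q¹·f_q² + e_q²·f_q¹) + (−1)^{(p−1)(q−1)} (e_b¹·f_b² + e_b²·f_b¹). Let 𝒟 be the linear subspace of 𝒱 consisting of all ((f_p,f_q,f_b),(e_p,e_q,e_b)) satisfying f_p = (−1)^{pq+q+1} Dᵀ e_q + (−1)^{pq+q} Tᵀ e_b, f_q = D e_p, and f_b = (−1)^p T e_p. Then 𝒟 equals its orthogonal complement with respect to ⟨⟨·,·⟩⟩; that is, 𝒟 is a Dirac structure. -/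
open Matrix

/-- The space of flow-effort pairs `((f_p, f_q, f_b), (e_p, e_q, e_b))`. -/
abbrev PortVar (l m b : ℕ) :=
  ((Fin l → ℝ) × (Fin m → ℝ) × (Fin b → ℝ)) × ((Fin l → ℝ) × (Fin m → ℝ) × (Fin b → ℝ))

/-- The symmetric flow-effort pairing
`⟨⟨(f¹,e¹),(f²,e²)⟩⟩ = (e_p¹·f_p² + e_p²·f_p¹) + (−1)^{q(p−1)} (e_q¹·f_q² + e_q²·f_q¹)
  + (−1)^{(p−1)(q−1)} (e_b¹·f_b² + e_b²·f_b¹)`. -/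
noncomputable def pairing1 (p q l m b : ℕ) (x y : PortVar l m b) : ℝ :=
  (x.2.1 ⬝ᵥ y.1.1 + y.2.1 ⬝ᵥ x.1.1)
    + (-1 : ℝ) ^ (q * (p - 1)) * (x.2.2.1 ⬝ᵥ y.1.2.1 + y.2.2.1 ⬝ᵥ x.1.2.1)
    + (-1 : ℝ) ^ ((p - 1) * (q - 1)) * (x.2.2.2 ⬝ᵥ y.1.2.2 + y.2.2.2 ⬝ᵥ x.1.2.2)

/-- The simplicial Dirac structure in matrix representation:
`f_p = (−1)^{pq+q+1} Dᵀ e_q + (−1)^{pq+q} Tᵀ e_b`, `f_q = D e_p`, `f_b = (−1)^p T e_p`. -/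
def simplicialDirac (p q l m b : ℕ)
    (D : Matrix (Fin m) (Fin l) ℝ) (T : Matrix (Fin b) (Fin l) ℝ) :
    Set (PortVar l m b) :=
  {x | x.1.1 = (-1 : ℝ) ^ (p * q + q + 1) • Dᵀ.mulVec x.2.2.1
          + (-1 : ℝ) ^ (p * q + q) • Tᵀ.mulVec x.2.2.2
      ∧ x.1.2.1 = D.mulVec x.2.1
      ∧ x.1.2.2 = (-1 : ℝ) ^ p • T.mulVec x.2.1}

theorem pairing1_of_mem (p q l m b : ℕ) (hp : 1 ≤ p) (hq : 1 ≤ q)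
    (D : Matrix (Fin m) (Fin l) ℝ) (T : Matrix (Fin b) (Fin l) ℝ)
    (x y : PortVar l m b) (hx : x ∈ simplicialDirac p q l m b D T) :
    pairing1 p q l m b x y =
      x.2.1 ⬝ᵥ (y.1.1 - ((-1 : ℝ) ^ (p * q + q + 1) • Dᵀ.mulVec y.2.2.1
          + (-1 : ℝ) ^ (p * q + q) • Tᵀ.mulVec y.2.2.2))
      + (-1 : ℝ) ^ (q * (p - 1)) * (x.2.2.1 ⬝ᵥ (y.1.2.1 - D.mulVec y.2.1))
      + (-1 : ℝ) ^ ((p - 1) * (q - 1)) *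
        (x.2.2.2 ⬝ᵥ (y.1.2.2 - (-1 : ℝ) ^ p • T.mulVec y.2.1)) := by
  obtain ⟨h1, h2, h3⟩ := hx
  have key : ∀ {k : ℕ} (M : Matrix (Fin k) (Fin l) ℝ) (u : Fin l → ℝ) (v : Fin k → ℝ),
      u ⬝ᵥ Mᵀ.mulVec v = v ⬝ᵥ M.mulVec u := by
    intro k M u v
    rw [Matrix.mulVec_transpose, dotProduct_comm, Matrix.dotProduct_mulVec]
  have ha : (-1 : ℝ) ^ (q * (p - 1)) = (-1 : ℝ) ^ (p * q + q) := by
    obtain ⟨p, rfl⟩ := Nat.exists_eq_add_of_le' hp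
    have : (p + 1) * q + q = q * (p + 1 - 1) + 2 * q := by simp; ring
    rw [this, pow_add, pow_mul (-1 : ℝ) 2]; simp
  have hc : (-1 : ℝ) ^ ((p - 1) * (q - 1)) * (-1 : ℝ) ^ p = - (-1 : ℝ) ^ (p * q + q) := by
    obtain ⟨p, rfl⟩ := Nat.exists_eq_add_of_le' hp
    obtain ⟨q, rfl⟩ := Nat.exists_eq_add_of_le' hq
    have : (p + 1) * (q + 1) + (q + 1)
        = (p + 1 - 1) * (q + 1 - 1) + (p + 1) + 2 * q + 1 := by simp; ring
    rw [this, ← pow_add, pow_succ _ ((p + 1 - 1) * (q + 1 - 1) + (p + 1) + 2 * q), pow_add _ _ (2 * q), pow_mul (-1 : ℝ) 2]; simp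
  unfold pairing1
  rw [h1, h2, h3, ha, pow_succ]
  simp only [dotProduct_sub, dotProduct_add, dotProduct_smul, key, smul_eq_mul]
  linear_combination (y.2.2.2 ⬝ᵥ T.mulVec x.2.1 + x.2.2.2 ⬝ᵥ T.mulVec y.2.1) * hc

/-- The simplicial Dirac structure equals its orthogonal complement with respect to the
symmetrized flow-effort pairing, i.e. it is a Dirac structure. -/
theorem simplicialDirac_eq_orthogonal (p q l m b : ℕ) (hp : 1 ≤ p) (hq : 1 ≤ q)
    (D : Matrix (Fin m) (Fin l) ℝ) (T : Matrix (Fin b) (Fin l) ℝ) :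
    simplicialDirac p q l m b D T
      = {y : PortVar l m b | ∀ x ∈ simplicialDirac p q l m b D T, pairing1 p q l m b x y = 0} := by
  ext y
  constructor
  · intro hy x hx
    rw [pairing1_of_mem p q l m b hp hq D T x y hx]
    obtain ⟨h1, h2, h3⟩ := hy
    rw [← h1, ← h2, ← h3]
    simp
  · intro hy
    have H : ∀ (u : Fin l → ℝ) (v : Fin m → ℝ) (w : Fin b → ℝ),
        u ⬝ᵥ (y.1.1 - ((-1 : ℝ) ^ (p * q + q + 1) • Dᵀ.mulVec y.2.2.1
          + (-1 : ℝ) ^ (p * q + q) • Tᵀ.mulVec y.2.2.2))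
        + (-1 : ℝ) ^ (q * (p - 1)) * (v ⬝ᵥ (y.1.2.1 - D.mulVec y.2.1))
        + (-1 : ℝ) ^ ((p - 1) * (q - 1)) *
          (w ⬝ᵥ (y.1.2.2 - (-1 : ℝ) ^ p • T.mulVec y.2.1)) = 0 := by
      intro u v w
      have hx : (((-1 : ℝ) ^ (p * q + q + 1) • Dᵀ.mulVec v
          + (-1 : ℝ) ^ (p * q + q) • Tᵀ.mulVec w, D.mulVec u, (-1 : ℝ) ^ p • T.mulVec u),
          (u, v, w)) ∈ simplicialDirac p q l m b D T := ⟨rfl, rfl, rfl⟩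
      have h := hy _ hx
      rw [pairing1_of_mem p q l m b hp hq D T _ y hx] at h
      exact h
    refine ⟨?_, ?_, ?_⟩
    · have h := H (y.1.1 - ((-1 : ℝ) ^ (p * q + q + 1) • Dᵀ.mulVec y.2.2.1
          + (-1 : ℝ) ^ (p * q + q) • Tᵀ.mulVec y.2.2.2)) 0 0
      rw [zero_dotProduct, zero_dotProduct, mul_zero, mul_zero, add_zero, add_zero,
        dotProduct_self_eq_zero] at h
      exact sub_eq_zero.mp h
    · have h := H 0 (y.1.2.1 - D.mulVec y.2.1) 0
      rw [zero_dotProduct, zero_dotProduct, mul_zero, zero_add, add_zero, mul_eq_zero,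
        dotProduct_self_eq_zero] at h
      exact sub_eq_zero.mp (h.resolve_left (pow_ne_zero _ (by norm_num)))
    · have h := H 0 0 (y.1.2.2 - (-1 : ℝ) ^ p • T.mulVec y.2.1)
      rw [zero_dotProduct, zero_dotProduct, mul_zero, zero_add, zero_add, mul_eq_zero,
        dotProduct_self_eq_zero] at h
      exact sub_eq_zero.mp (h.resolve_left (pow_ne_zero _ (by norm_num)))
end

section
/- Let p, q ≥ 1 and l, m, b be natural numbers, let D be a real m×l matrix and T a real b×l matrix. On the real vector space 𝒱 = (ℝ^m × ℝ^l × ℝ^b) × (ℝ^m × ℝ^l × ℝ^b), whose elements are pairs ((f_p, f_q, f_b), (e_p, e_q, e_b)) of flows and efforts, define the symmetric bilinear form ⟨⟨(f¹,e¹),(f²,e²)⟩⟩ = (−1)^{p(q−1)} (e_p¹·f_p² + e_p²·f_p¹) + (e_q¹·f_q² + e_q²·f_q¹) + (e_b¹·f_b² + e_b²·f_b¹). Let 𝒟̃ be the linear subspace of 𝒱 consisting of all ((f_p,f_q,f_b),(e_p,e_q,e_b)) satisfying f_p = (−1)^{pq+1} D e_q, f_q = (−1)^p Dᵀ e_p +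 (−1)^{p−1} Tᵀ f_b, and e_b = (−1)^p T e_q. Then 𝒟̃ equals its orthogonal complement with respect to ⟨⟨·,·⟩⟩; that is, 𝒟̃ is a Dirac structure. -/
open Matrix

/-- The space of flow-effort pairs `((f_p, f_q, f_b), (e_p, e_q, e_b))`, where
`f_p, e_p ∈ ℝ^m`, `f_q, e_q ∈ ℝ^l`, `f_b, e_b ∈ ℝ^b`. -/
abbrev PortVar2 (l m b : ℕ) :=
  ((Fin m → ℝ) × (Fin l → ℝ) × (Fin b → ℝ)) × ((Fin m → ℝ) × (Fin l → ℝ) × (Fin b → ℝ))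

/-- The symmetric flow-effort pairing
`⟨⟨(f¹,e¹),(f²,e²)⟩⟩ = (−1)^{p(q−1)} (e_p¹·f_p² + e_p²·f_p¹) + (e_q¹·f_q² + e_q²·f_q¹)
  + (e_b¹·f_b² + e_b²·f_b¹)`. -/
noncomputable def pairing2 (p q l m b : ℕ) (x y : PortVar2 l m b) : ℝ :=
  (-1 : ℝ) ^ (p * (q - 1)) * (x.2.1 ⬝ᵥ y.1.1 + y.2.1 ⬝ᵥ x.1.1)
    + (x.2.2.1 ⬝ᵥ y.1.2.1 + y.2.2.1 ⬝ᵥ x.1.2.1)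
    + (x.2.2.2 ⬝ᵥ y.1.2.2 + y.2.2.2 ⬝ᵥ x.1.2.2)

/-- The second simplicial Dirac structure in matrix representation:
`f_p = (−1)^{pq+1} D e_q`, `f_q = (−1)^p Dᵀ e_p + (−1)^{p−1} Tᵀ f_b`,
`e_b = (−1)^p T e_q`. -/
def simplicialDirac2 (p q l m b : ℕ)
    (D : Matrix (Fin m) (Fin l) ℝ) (T : Matrix (Fin b) (Fin l) ℝ) :
    Set (PortVar2 l m b) :=
  {x | x.1.1 = (-1 : ℝ) ^ (p * q + 1) • D.mulVec x.2.2.1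
      ∧ x.1.2.1 = (-1 : ℝ) ^ p • Dᵀ.mulVec x.2.1
          + (-1 : ℝ) ^ (p - 1) • Tᵀ.mulVec x.1.2.2
      ∧ x.2.2.2 = (-1 : ℝ) ^ p • T.mulVec x.2.2.1}

theorem pairing2_key (p q l m b : ℕ) (hp : 1 ≤ p) (hq : 1 ≤ q)
    (D : Matrix (Fin m) (Fin l) ℝ) (T : Matrix (Fin b) (Fin l) ℝ)
    (x y : PortVar2 l m b) (hx : x ∈ simplicialDirac2 p q l m b D T) :
    pairing2 p q l m b x y =
      (-1 : ℝ) ^ (p * (q - 1)) * (x.2.1 ⬝ᵥ (y.1.1 - (-1 : ℝ) ^ (p * q + 1) • D.mulVec y.2.2.1))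
      + x.2.2.1 ⬝ᵥ (y.1.2.1 - ((-1 : ℝ) ^ p • Dᵀ.mulVec y.2.1
          + (-1 : ℝ) ^ (p - 1) • Tᵀ.mulVec y.1.2.2))
      + x.1.2.2 ⬝ᵥ (y.2.2.2 - (-1 : ℝ) ^ p • T.mulVec y.2.2.1) := by
  obtain ⟨⟨fp, fq, fb⟩, ep, eq, eb⟩ := x
  obtain ⟨⟨gp, gq, gb⟩, hp', hq', hb'⟩ := y
  obtain ⟨h1, h2, h3⟩ := hx
  simp only at h1 h2 h3
  subst h1 h2 h3
  obtain ⟨p, rfl⟩ := Nat.exists_eq_add_of_le' hp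
  obtain ⟨q, rfl⟩ := Nat.exists_eq_add_of_le' hq
  have tr : ∀ {k : ℕ} (A : Matrix (Fin k) (Fin l) ℝ) (u : Fin l → ℝ) (v : Fin k → ℝ),
      u ⬝ᵥ Aᵀ.mulVec v = v ⬝ᵥ A.mulVec u := by
    intro k A u v
    rw [Matrix.mulVec_transpose, dotProduct_comm, ← Matrix.dotProduct_mulVec]
  have s1 : (-1 : ℝ) ^ ((p + 1) * q) * (-1 : ℝ) ^ ((p + 1) * (q + 1) + 1) = (-1) ^ p := by
    rw [← pow_add, show (p + 1) * q + ((p + 1) * (q + 1) + 1) = 2 * ((p + 1) * q + 1) + p by ring,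
      pow_add, pow_mul]
    simp
  simp only [pairing2, dotProduct_sub, dotProduct_add, dotProduct_smul, smul_dotProduct, tr,
    smul_eq_mul, Nat.add_sub_cancel]
  rw [dotProduct_comm (T.mulVec eq) gb, dotProduct_comm hb' fb]
  have s2 : (-1 : ℝ) ^ (p + 1) = - (-1) ^ p := by ring
  rw [s2]
  linear_combination (hp' ⬝ᵥ D.mulVec eq + ep ⬝ᵥ D.mulVec hq') * s1

/-- The second simplicial Dirac structure equals its orthogonal complement with respect to
the symmetrized flow-effort pairing, i.e. it is a Dirac structure. -/
theorem simplicialDirac2_eq_orthogonal (p q l m b : ℕ) (hp : 1 ≤ p) (hq : 1 ≤ q)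
    (D : Matrix (Fin m) (Fin l) ℝ) (T : Matrix (Fin b) (Fin l) ℝ) :
    simplicialDirac2 p q l m b D T
      = {y : PortVar2 l m b |
          ∀ x ∈ simplicialDirac2 p q l m b D T, pairing2 p q l m b x y = 0} := by
  ext y
  constructor
  · intro hy x hx
    rw [pairing2_key p q l m b hp hq D T x y hx]
    obtain ⟨h1, h2, h3⟩ := hy
    rw [sub_eq_zero.2 h1, sub_eq_zero.2 h2, sub_eq_zero.2 h3]
    simp
  · intro hy
    have key : ∀ (u : Fin m → ℝ) (v : Fin l → ℝ) (w : Fin b → ℝ), _ = (0 : ℝ) :=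
      fun u v w => (pairing2_key p q l m b hp hq D T
        (((-1 : ℝ) ^ (p * q + 1) • D.mulVec v,
          (-1 : ℝ) ^ p • Dᵀ.mulVec u + (-1 : ℝ) ^ (p - 1) • Tᵀ.mulVec w, w),
          u, v, (-1 : ℝ) ^ p • T.mulVec v) y ⟨rfl, rfl, rfl⟩).symm.trans
          (hy _ ⟨rfl, rfl, rfl⟩)
    simp only at key
    refine ⟨?_, ?_, ?_⟩
    · have h := key (y.1.1 - (-1 : ℝ) ^ (p * q + 1) • D.mulVec y.2.2.1) 0 0
      rw [zero_dotProduct, zero_dotProduct, add_zero, add_zero] at h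
      exact sub_eq_zero.1 (dotProduct_self_eq_zero.1
        ((mul_eq_zero.1 h).resolve_left (pow_ne_zero _ (by norm_num))))
    · have h := key 0 (y.1.2.1 - ((-1 : ℝ) ^ p • Dᵀ.mulVec y.2.1
          + (-1 : ℝ) ^ (p - 1) • Tᵀ.mulVec y.1.2.2)) 0
      rw [zero_dotProduct, zero_dotProduct, add_zero, mul_zero, zero_add] at h
      exact sub_eq_zero.1 (dotProduct_self_eq_zero.1 h)
    · have h := key 0 0 (y.2.2.2 - (-1 : ℝ) ^ p • T.mulVec y.2.2.1)
      rw [zero_dotProduct, zero_dotProduct, mul_zero, zero_add, zero_add] at h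
      exact sub_eq_zero.1 (dotProduct_self_eq_zero.1 h)
end

section
/- Let p, q ≥ 1 and l, m, b be natural numbers, D a real m×l matrix, T a real b×l matrix, and let M_p (l×l) and M_q (m×m) be symmetric real matrices. Suppose e_p : ℝ → ℝ^l and e_q : ℝ → ℝ^m are differentiable curves and e_b : ℝ → ℝ^b is an arbitrary function such that for all t: M_p e_p′(t) = −( (−1)^{pq+q+1} Dᵀ e_q(t) + (−1)^{pq+q} Tᵀ e_b(t) ) and M_q e_q′(t) = −D e_p(t). Define the boundary output f_b(t) = (−1)^p T e_p(t) and the Hamiltonian H(t) = ½ ( e_p(t) · M_p e_p(t) + (−1)^{q(p−1)} e_q(t) · M_q e_q(t) ). Then for all t, H′(t) = (−1)^{(p−1)(q−1)} e_b(t) · f_b(t). -/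
open Matrix

theorem quad_hasDerivAt_aux {n : ℕ} (M : Matrix (Fin n) (Fin n) ℝ) (hM : M.IsSymm)
    (e : ℝ → Fin n → ℝ) (he : Differentiable ℝ e) (t : ℝ) :
    HasDerivAt (fun s => e s ⬝ᵥ M.mulVec (e s)) (2 * (e t ⬝ᵥ M.mulVec (deriv e t))) t := by
  have h1 : ∀ i, HasDerivAt (fun s => e s i) (deriv e t i) t :=
    hasDerivAt_pi.1 (he t).hasDerivAt
  have h2 : ∀ i, HasDerivAt (fun s => M.mulVec (e s) i) (M.mulVec (deriv e t) i) t := by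
    intro i
    simp only [Matrix.mulVec, dotProduct]
    exact HasDerivAt.fun_sum fun j _ => (h1 j).const_mul (M i j)
  have h3 : HasDerivAt (fun s => e s ⬝ᵥ M.mulVec (e s))
      (∑ i, (deriv e t i * M.mulVec (e t) i + e t i * M.mulVec (deriv e t) i)) t := by
    simp only [dotProduct]
    exact HasDerivAt.fun_sum fun i _ => (h1 i).mul (h2 i)
  convert h3 using 1
  rw [Finset.sum_add_distrib]
  change _ = deriv e t ⬝ᵥ M.mulVec (e t) + e t ⬝ᵥ M.mulVec (deriv e t)
  have h4 : deriv e t ⬝ᵥ M.mulVec (e t) = e t ⬝ᵥ M.mulVec (deriv e t) := by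
    rw [Matrix.dotProduct_mulVec, ← Matrix.mulVec_transpose, hM.eq, dotProduct_comm]
  rw [h4]; ring

/-- Energy balance `dH/dt = (−1)^{(p−1)(q−1)} e_b · f_b` for the spatially discretized
port-Hamiltonian system defined with respect to the first simplicial Dirac structure,
with boundary output `f_b = (−1)^p T e_p` and Hamiltonian
`H = ½ (e_p · M_p e_p + (−1)^{q(p−1)} e_q · M_q e_q)`. -/
theorem energy_balance_first (p q l m b : ℕ) (hp : 1 ≤ p) (hq : 1 ≤ q)
    (D : Matrix (Fin m) (Fin l) ℝ) (T : Matrix (Fin b) (Fin l) ℝ)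
    (Mp : Matrix (Fin l) (Fin l) ℝ) (Mq : Matrix (Fin m) (Fin m) ℝ)
    (hMp : Mp.IsSymm) (hMq : Mq.IsSymm)
    (e_p : ℝ → Fin l → ℝ) (e_q : ℝ → Fin m → ℝ) (e_b : ℝ → Fin b → ℝ)
    (hdp : Differentiable ℝ e_p) (hdq : Differentiable ℝ e_q)
    (hfp : ∀ t, Mp.mulVec (deriv e_p t)
        = -((-1 : ℝ) ^ (p * q + q + 1) • Dᵀ.mulVec (e_q t)
            + (-1 : ℝ) ^ (p * q + q) • Tᵀ.mulVec (e_b t)))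
    (hfq : ∀ t, Mq.mulVec (deriv e_q t) = -(D.mulVec (e_p t))) :
    ∀ t, deriv (fun s => (1 / 2 : ℝ) * (e_p s ⬝ᵥ Mp.mulVec (e_p s)
            + (-1 : ℝ) ^ (q * (p - 1)) * (e_q s ⬝ᵥ Mq.mulVec (e_q s)))) t
      = (-1 : ℝ) ^ ((p - 1) * (q - 1))
          * (e_b t ⬝ᵥ ((-1 : ℝ) ^ p • T.mulVec (e_p t))) := by
  intro t
  have h := ((quad_hasDerivAt_aux Mp hMp e_p hdp t).add
    ((quad_hasDerivAt_aux Mq hMq e_q hdq t).const_mul ((-1 : ℝ) ^ (q * (p - 1))))).const_mul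
      (1 / 2 : ℝ)
  refine h.deriv.trans ?_
  rw [hfp, hfq]
  have hD : e_p t ⬝ᵥ Dᵀ.mulVec (e_q t) = e_q t ⬝ᵥ D.mulVec (e_p t) := by
    rw [Matrix.dotProduct_mulVec, Matrix.vecMul_transpose, dotProduct_comm]
  have hT : e_p t ⬝ᵥ Tᵀ.mulVec (e_b t) = e_b t ⬝ᵥ T.mulVec (e_p t) := by
    rw [Matrix.dotProduct_mulVec, Matrix.vecMul_transpose, dotProduct_comm]
  simp only [dotProduct_neg, dotProduct_add, dotProduct_smul, smul_eq_mul, hD, hT]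
  obtain ⟨a, rfl⟩ := Nat.exists_eq_add_of_le' hp
  obtain ⟨c, rfl⟩ := Nat.exists_eq_add_of_le' hq
  simp only [Nat.add_sub_cancel]
  generalize e_q t ⬝ᵥ D.mulVec (e_p t) = x
  generalize e_b t ⬝ᵥ T.mulVec (e_p t) = y
  have e1 : (-1 : ℝ) ^ ((a + 1) * (c + 1) + (c + 1)) = (-1) ^ (a * c) * (-1) ^ a := by
    rw [show (a + 1) * (c + 1) + (c + 1) = a * c + a + 2 * (c + 1) by ring, pow_add _ (a*c+a),
      pow_mul]
    simp [pow_add]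
  have e2 : (-1 : ℝ) ^ ((c + 1) * a) = (-1) ^ (a * c) * (-1) ^ a := by
    rw [← pow_add]; congr 1; ring
  rw [pow_succ _ ((a + 1) * (c + 1) + (c + 1)), e1, e2, pow_succ _ a]
  ring
end

section
/- Let p, q ≥ 1 and l, m, b be natural numbers, R ≥ 0 a real number, D a real m×l matrix, T a real b×l matrix, and M_q a symmetric positive-semidefinite real m×m matrix. Let H : ℝ^l → ℝ be a differentiable function with gradient ∇H, let ê_b : ℝ → ℝ^b be arbitrary, and let x : ℝ → ℝ^l be a differentiable curve satisfying for all t: x′(t) = −R Dᵀ M_q D ∇H(x(t)) + (−1)^{pq+q−1} Tᵀ ê_b(t). Define f_b(t) = (−1)^p T ∇H(x(t)). Then for all t, the derivative of t ↦ H(x(t)) satisfies (H ∘ x)′(t) ≤ (−1)^{(p−1)(q−1)} ê_b(t) · f_b(t). -/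
open Matrix

/-- Passivity inequality `dH/dt ≤ (−1)^{(p−1)(q−1)} ê_b · f_b` for the spatially
discretized diffusion (relaxation) dynamics
`x′ = −R Dᵀ M_q D ∇H(x) + (−1)^{pq+q−1} Tᵀ ê_b`, with boundary output
`f_b = (−1)^p T ∇H(x)`. -/
theorem passivity_diffusion (p q l m b : ℕ) (hp : 1 ≤ p) (hq : 1 ≤ q)
    (R : ℝ) (hR : 0 ≤ R)
    (D : Matrix (Fin m) (Fin l) ℝ) (T : Matrix (Fin b) (Fin l) ℝ)
    (Mq : Matrix (Fin m) (Fin m) ℝ) (hMq : Mq.PosSemidef)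
    (H : (Fin l → ℝ) → ℝ) (gradH : (Fin l → ℝ) → (Fin l → ℝ))
    (hH : Differentiable ℝ H)
    (hgrad : ∀ y v, fderiv ℝ H y v = gradH y ⬝ᵥ v)
    (e_b : ℝ → Fin b → ℝ)
    (x : ℝ → Fin l → ℝ) (hx : Differentiable ℝ x)
    (hode : ∀ t, deriv x t
        = -(R • Dᵀ.mulVec (Mq.mulVec (D.mulVec (gradH (x t)))))
          + (-1 : ℝ) ^ (p * q + q - 1) • Tᵀ.mulVec (e_b t)) :
    ∀ t, deriv (H ∘ x) t
      ≤ (-1 : ℝ) ^ ((p - 1) * (q - 1))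
          * (e_b t ⬝ᵥ ((-1 : ℝ) ^ p • T.mulVec (gradH (x t)))) := by
  intro t
  have h1 : deriv (H ∘ x) t = gradH (x t) ⬝ᵥ deriv x t := by
    rw [← hgrad]
    exact ((hH (x t)).hasFDerivAt.comp_hasDerivAt t (hx t).hasDerivAt).deriv
  have key : ∀ {k : ℕ} (A : Matrix (Fin k) (Fin l) ℝ) (g : Fin l → ℝ) (w : Fin k → ℝ),
      g ⬝ᵥ Aᵀ.mulVec w = w ⬝ᵥ A.mulVec g := by
    intro k A g w
    rw [Matrix.mulVec_transpose, dotProduct_comm, Matrix.dotProduct_mulVec]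
  have h2 := hMq.dotProduct_mulVec_nonneg (D.mulVec (gradH (x t)))
  rw [star_trivial, dotProduct_comm] at h2
  have hs : (-1 : ℝ) ^ (p * q + q - 1) = (-1 : ℝ) ^ ((p - 1) * (q - 1)) * (-1 : ℝ) ^ p := by
    obtain ⟨a, rfl⟩ := Nat.exists_eq_add_of_le' hp
    obtain ⟨c, rfl⟩ := Nat.exists_eq_add_of_le' hq
    rw [← pow_add]
    have : (a + 1) * (c + 1) + (c + 1) - 1
        = ((a + 1 - 1) * (c + 1 - 1) + (a + 1)) + 2 * c := by
      simp only [Nat.add_sub_cancel, ← Nat.add_assoc]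
      ring
    rw [this, pow_add _ _ (2 * c), pow_mul]
    simp
  rw [h1, hode, dotProduct_add, dotProduct_neg, dotProduct_smul, dotProduct_smul, key, key,
    dotProduct_smul, hs]
  simp only [smul_eq_mul]
  have h3 := mul_nonneg hR h2
  linarith
end

section
/- Let p, q ≥ 1 and l, m, b be natural numbers; set σ = (−1)^{q(p−1)}, s₁ = (−1)^{pq+q+1}, s₂ = (−1)^{pq+q}. Let D be a real m×l matrix, T a real b×l matrix, M_p (l×l) and M_q (m×m) symmetric real matrices. Suppose e_p, e_p* : ℝ → ℝ^l, e_q, e_q* : ℝ → ℝ^m, r_p : ℝ → ℝ^l, r_q : ℝ → ℝ^m are differentiable and e_b : ℝ → ℝ^b is arbitrary, and that for all t: M_p e_p′ = −(s₁ Dᵀ e_q + s₂ Tᵀ e_b), M_q e_q′ = −D e_p, M_p e_p*′ + r_p′ = −(s₁ Dᵀ e_q* + s₂ Tᵀ e_b), and M_q e_q*′ + r_q′ = −D e_p* (with the same boundary effort e_b in both systems). Then the errors δe_p = e_p* − e_p and δe_q = e_q* − e_q satisfy, for all t: δe_p(t) · M_p δe_p′(t) + σ δe_q(t) · M_q δe_q′(t)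 = −δe_p(t) · r_p′(t) − σ δe_q(t) · r_q′(t). -/
open Matrix

/-- Error-energy identity: the exact (integrated) and discrete systems share the same
boundary effort `e_b`, and the errors `δe_p = e_p* − e_p`, `δe_q = e_q* − e_q` satisfy
`δe_p · M_p δe_p′ + σ δe_q · M_q δe_q′ = −δe_p · r_p′ − σ δe_q · r_q′`,
where `σ = (−1)^{q(p−1)}`, `s₁ = (−1)^{pq+q+1}`, `s₂ = (−1)^{pq+q}`. -/
theorem error_energy_identity (p q l m b : ℕ) (hp : 1 ≤ p) (hq : 1 ≤ q)
    (D : Matrix (Fin m) (Fin l) ℝ) (T : Matrix (Fin b) (Fin l) ℝ)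
    (Mp : Matrix (Fin l) (Fin l) ℝ) (Mq : Matrix (Fin m) (Fin m) ℝ)
    (hMp : Mp.IsSymm) (hMq : Mq.IsSymm)
    (e_p e_ps : ℝ → Fin l → ℝ) (e_q e_qs : ℝ → Fin m → ℝ)
    (r_p : ℝ → Fin l → ℝ) (r_q : ℝ → Fin m → ℝ) (e_b : ℝ → Fin b → ℝ)
    (hdep : Differentiable ℝ e_p) (hdeps : Differentiable ℝ e_ps)
    (hdeq : Differentiable ℝ e_q) (hdeqs : Differentiable ℝ e_qs)
    (hdrp : Differentiable ℝ r_p) (hdrq : Differentiable ℝ r_q)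
    (h1 : ∀ t, Mp.mulVec (deriv e_p t)
        = -((-1 : ℝ) ^ (p * q + q + 1) • Dᵀ.mulVec (e_q t)
            + (-1 : ℝ) ^ (p * q + q) • Tᵀ.mulVec (e_b t)))
    (h2 : ∀ t, Mq.mulVec (deriv e_q t) = -(D.mulVec (e_p t)))
    (h3 : ∀ t, Mp.mulVec (deriv e_ps t) + deriv r_p t
        = -((-1 : ℝ) ^ (p * q + q + 1) • Dᵀ.mulVec (e_qs t)
            + (-1 : ℝ) ^ (p * q + q) • Tᵀ.mulVec (e_b t)))
    (h4 : ∀ t, Mq.mulVec (deriv e_qs t) + deriv r_q t = -(D.mulVec (e_ps t))) :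
    ∀ t, (e_ps t - e_p t) ⬝ᵥ Mp.mulVec (deriv (fun s => e_ps s - e_p s) t)
        + (-1 : ℝ) ^ (q * (p - 1))
            * ((e_qs t - e_q t) ⬝ᵥ Mq.mulVec (deriv (fun s => e_qs s - e_q s) t))
      = -((e_ps t - e_p t) ⬝ᵥ deriv r_p t)
        - (-1 : ℝ) ^ (q * (p - 1)) * ((e_qs t - e_q t) ⬝ᵥ deriv r_q t) := by
  intro t
  obtain ⟨k, rfl⟩ : ∃ k, p = k + 1 := ⟨p - 1, by omega⟩
  have hs : (-1 : ℝ) ^ ((k + 1) * q + q + 1) = -(-1 : ℝ) ^ (q * (k + 1 - 1)) := by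
    have : (k + 1) * q + q + 1 = q * k + 2 * q + 1 := by ring
    rw [this, Nat.add_sub_cancel, pow_succ, pow_add, pow_mul (-1 : ℝ) 2 q]
    simp
  have hA : Mp.mulVec (deriv (fun s => e_ps s - e_p s) t)
      = -deriv r_p t + (-1 : ℝ) ^ (q * (k + 1 - 1)) • Dᵀ.mulVec (e_qs t - e_q t) := by
    rw [deriv_fun_sub (hdeps t) (hdep t), Matrix.mulVec_sub, h1 t, eq_sub_of_add_eq (h3 t), hs,
      Matrix.mulVec_sub, smul_sub, neg_smul, neg_smul]
    abel
  have hB : Mq.mulVec (deriv (fun s => e_qs s - e_q s) t)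
      = -deriv r_q t - D.mulVec (e_ps t - e_p t) := by
    rw [deriv_fun_sub (hdeqs t) (hdeq t), Matrix.mulVec_sub, h2 t, eq_sub_of_add_eq (h4 t),
      Matrix.mulVec_sub]
    abel
  have hC : (e_ps t - e_p t) ⬝ᵥ Dᵀ.mulVec (e_qs t - e_q t)
      = (e_qs t - e_q t) ⬝ᵥ D.mulVec (e_ps t - e_p t) := by
    rw [Matrix.mulVec_transpose, dotProduct_comm, Matrix.dotProduct_mulVec]
  rw [hA, hB, dotProduct_add, dotProduct_sub, dotProduct_neg, dotProduct_neg, dotProduct_smul,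
    hC, smul_eq_mul]
  ring
end
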